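/- Let 2 ≤ q < p < ∞ and let M be an n-point subset of ℓ_p. Suppose β ≥ 1 is such that for every Δ' > 0, M admits a (β,Δ')-Lipschitz decomposition, and β_q ≥ 1 is such that every n-point subset of ℓ_q admits a (β_q,Δ')-Lipschitz decomposition for every Δ' > 0. Then for every Δ > 0, M admits a (β_new, Δ)-Lipschitz decomposition, where β_new = 4·(p/(2q))^{q/p}·β_q^{q/p}·β^{1−q/p}. -/

import Mathlib

noncomputable section

open scoped NNReal ENNReal

/-- A `(β, Δ)`-Lipschitz decomposition of a (pseudo)metric space `α`: a probability
distribution over partitions of `α` (encoded as equivalence relations / setoids) such that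
every cluster of every partition in the support has diameter at most `Δ` (i.e. any two
equivalent points are at distance at most `Δ`), and any two points `x, y` are separated
(put in different clusters) with probability at most `β * dist x y / Δ`. -/
def LipschitzDecomp (α : Type*) [PseudoMetricSpace α] (β Δ : ℝ) : Prop :=
  ∃ D : PMF (Setoid α),
    (∀ R ∈ D.support, ∀ x y : α, R.r x y → dist x y ≤ Δ) ∧
    (∀ x y : α, D.toOuterMeasure {R | ¬ R.r x y} ≤ ENNReal.ofReal (β * dist x y / Δ))

/-- The signed power `a ↦ sign a * |a| ^ s`. -/
def signedPow (s a : ℝ) : ℝ := a * |a| ^ (s - 1)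

theorem signedPow_of_nonneg {s a : ℝ} (hs : 0 < s) (ha : 0 ≤ a) : signedPow s a = a ^ s := by
  rcases ha.eq_or_lt with rfl | ha
  · simp [signedPow, Real.zero_rpow hs.ne']
  · rw [signedPow, abs_of_pos ha, Real.rpow_sub_one ha.ne', mul_div_cancel₀ _ ha.ne']

theorem signedPow_neg (s a : ℝ) : signedPow s (-a) = -signedPow s a := by
  simp [signedPow]

theorem abs_signedPow {s : ℝ} (hs : 0 < s) (a : ℝ) : |signedPow s a| = |a| ^ s := by
  rw [← signedPow_of_nonneg hs (abs_nonneg a)]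
  simp only [signedPow, abs_mul, abs_abs]
  rw [abs_of_nonneg (Real.rpow_nonneg (abs_nonneg a) _)]

theorem hasDerivAt_signedPow {s : ℝ} (hs : 1 < s) (a : ℝ) :
    HasDerivAt (signedPow s) (s * |a| ^ (s - 1)) a := by
  have hpos : ∀ b : ℝ, 0 < b → HasDerivAt (signedPow s) (s * |b| ^ (s - 1)) b := by
    intro b hb
    rw [abs_of_pos hb]
    refine (Real.hasDerivAt_rpow_const (Or.inl hb.ne')).congr_of_eventuallyEq ?_
    filter_upwards [lt_mem_nhds hb] with x hx
    exact signedPow_of_nonneg (by linarith) hx.le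
  rcases lt_trichotomy a 0 with ha | rfl | ha
  · have h := (HasDerivAt.scomp a (hpos (-a) (by linarith)) (hasDerivAt_neg a)).neg
    have he : -(signedPow s ∘ Neg.neg) = signedPow s := by
      funext x
      simp [signedPow_neg]
    simpa [he] using h
  · rw [hasDerivAt_iff_tendsto_slope, abs_zero, Real.zero_rpow (by linarith), mul_zero]
    have hc : Filter.Tendsto (fun x : ℝ => |x| ^ (s - 1)) (nhdsWithin 0 {0}ᶜ) (nhds 0) := by
      have : ContinuousAt (fun x : ℝ => |x| ^ (s - 1)) 0 :=
        (continuous_abs.rpow_const fun _ => Or.inr (by linarith)).continuousAt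
      have h := this.tendsto.mono_left (nhdsWithin_le_nhds (s := {0}ᶜ))
      simpa [Real.zero_rpow (show s - 1 ≠ 0 by linarith)] using h
    refine hc.congr' ?_
    filter_upwards [self_mem_nhdsWithin] with x hx
    have hx : x ≠ 0 := hx
    simp only [slope_def_field, signedPow, zero_mul, sub_zero]
    field_simp
  · exact hpos a ha

/-- `a ↦ sign a * |a| ^ s` expands distances at least as much as `2 ^ (1 - s) * t ^ s`. -/
theorem abs_sub_rpow_le_abs_signedPow_sub {s : ℝ} (hs : 1 ≤ s) (a b : ℝ) :
    2 ^ (1 - s) * |a - b| ^ s ≤ |signedPow s a - signedPow s b| := by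
  have hs0 : 0 < s := by linarith
  have h2 : (2 : ℝ) ^ (1 - s) ≤ 1 :=
    Real.rpow_le_one_of_one_le_of_nonpos (by norm_num) (by linarith)
  have same : ∀ a b : ℝ, 0 ≤ b → b ≤ a →
      2 ^ (1 - s) * |a - b| ^ s ≤ |signedPow s a - signedPow s b| := by
    intro a b hb hab
    rw [signedPow_of_nonneg hs0 hb, signedPow_of_nonneg hs0 (hb.trans hab),
      abs_of_nonneg (sub_nonneg.2 hab)]
    have h := Real.add_rpow_le_rpow_add (sub_nonneg.2 hab) hb hs
    rw [sub_add_cancel] at h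
    have h0 : 0 ≤ (a - b) ^ s := Real.rpow_nonneg (sub_nonneg.2 hab) _
    refine le_trans ?_ (le_abs_self _)
    nlinarith
  have opp : ∀ a b : ℝ, 0 ≤ a → 0 ≤ b →
      2 ^ (1 - s) * |a - -b| ^ s ≤ |signedPow s a - signedPow s (-b)| := by
    intro a b ha hb
    rw [signedPow_neg, signedPow_of_nonneg hs0 ha, signedPow_of_nonneg hs0 hb, sub_neg_eq_add,
      sub_neg_eq_add, abs_of_nonneg (add_nonneg ha hb)]
    refine le_trans ?_ (le_abs_self _)
    have h := (convexOn_rpow hs).2 (Set.mem_Ici.2 ha) (Set.mem_Ici.2 hb)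
      (by norm_num : (0 : ℝ) ≤ 1 / 2) (by norm_num : (0 : ℝ) ≤ 1 / 2) (by norm_num)
    simp only [smul_eq_mul] at h
    rw [← mul_add, Real.mul_rpow (by norm_num) (add_nonneg ha hb), Real.div_rpow (by norm_num)
      (by norm_num), Real.one_rpow] at h
    rw [Real.rpow_sub (by norm_num), Real.rpow_one, div_eq_mul_one_div]
    linarith
  have main : ∀ a b : ℝ, 0 ≤ a →
      2 ^ (1 - s) * |a - b| ^ s ≤ |signedPow s a - signedPow s b| := by
    intro a b ha
    rcases le_total 0 b with hb | hb
    · rcases le_total a b with hab | hab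
      · rw [abs_sub_comm a, abs_sub_comm (signedPow s a)]
        exact same b a ha hab
      · exact same a b hb hab
    · simpa using opp a (-b) ha (by linarith)
  rcases le_total 0 a with ha | ha
  · exact main a b ha
  · have h := main (-a) (-b) (by linarith)
    rwa [signedPow_neg, signedPow_neg, ← neg_sub', ← neg_sub', abs_neg, abs_neg] at h

theorem abs_signedPow_sub_le {s p : ℝ} (hs : 1 < s) (hp : 1 ≤ p) (hsp : s - 1 ≤ p) (a b : ℝ) :
    |signedPow s a - signedPow s b| ≤
      s * |a - b| * ((|a| ^ p + |b| ^ p) / 2) ^ ((s - 1) / p) := by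
  have hp0 : 0 < p := by linarith
  set A := |a| ^ p with hA
  set B := |b| ^ p with hB
  have hA0 : 0 ≤ A := Real.rpow_nonneg (abs_nonneg a) _
  have hB0 : 0 ≤ B := Real.rpow_nonneg (abs_nonneg b) _
  set m := (A + B) / 2 with hm
  set θ := (s - 1) / p with hθ
  have hθ0 : 0 ≤ θ := div_nonneg (by linarith) hp0.le
  have hθ1 : θ ≤ 1 := (div_le_one hp0).2 hsp
  rcases (show 0 ≤ m by positivity).eq_or_lt with hm0 | hm0
  · have ha : a = 0 := by
      by_contra h
      have : 0 < A := Real.rpow_pos_of_pos (abs_pos.2 h) _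
      linarith
    have hb : b = 0 := by
      by_contra h
      have : 0 < B := Real.rpow_pos_of_pos (abs_pos.2 h) _
      linarith
    simp [ha, hb]
  have hK : 0 < m ^ θ := Real.rpow_pos_of_pos hm0 _
  have hd (t : ℝ) : HasDerivAt (fun t : ℝ => signedPow s (b + t * (a - b)) - signedPow s b)
      (s * |b + t * (a - b)| ^ (s - 1) * (a - b)) t := by
    have h1 : HasDerivAt (fun t : ℝ => b + t * (a - b)) (a - b) t := by
      simpa using ((hasDerivAt_id t).mul_const (a - b)).const_add b
    exact ((hasDerivAt_signedPow hs (b + t * (a - b))).comp t h1).sub_const _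
  have hbd (t : ℝ) : HasDerivAt (fun t : ℝ => s * |a - b| * m ^ θ *
        ((1 - θ) * t + θ / m * (B * (t - t ^ 2 / 2) + A * (t ^ 2 / 2))))
      (s * |a - b| * m ^ θ * ((1 - θ) + θ / m * (B * (1 - t) + A * t))) t := by
    have h2 : HasDerivAt (fun t : ℝ => t ^ 2 / 2) t t := by
      simpa using (hasDerivAt_pow 2 t).div_const 2
    have h1 := hasDerivAt_id t
    simpa using (((h1.const_mul (1 - θ)).add ((((h1.sub h2).const_mul B).add
      (h2.const_mul A)).const_mul (θ / m))).const_mul (s * |a - b| * m ^ θ))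
  have key (t : ℝ) (ht : t ∈ Set.Ico (0 : ℝ) 1) :
      ‖s * |b + t * (a - b)| ^ (s - 1) * (a - b)‖ ≤
        s * |a - b| * m ^ θ * ((1 - θ) + θ / m * (B * (1 - t) + A * t)) := by
    set z := b + t * (a - b) with hz
    have hz0 : 0 ≤ |z| ^ p := Real.rpow_nonneg (abs_nonneg z) _
    have hconv : |z| ^ p ≤ B * (1 - t) + A * t := by
      have h := (convexOn_rpow hp).2 (Set.mem_Ici.2 (abs_nonneg b)) (Set.mem_Ici.2 (abs_nonneg a))
        (by linarith [ht.2] : 0 ≤ 1 - t) ht.1 (by ring)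
      simp only [smul_eq_mul] at h
      have h' : |z| ≤ (1 - t) * |b| + t * |a| := by
        have e : z = (1 - t) * b + t * a := by rw [hz]; ring
        rw [e]
        refine (abs_add_le _ _).trans ?_
        rw [abs_mul, abs_mul, abs_of_nonneg ht.1, abs_of_nonneg (by linarith [ht.2] : 0 ≤ 1 - t)]
      have := Real.rpow_le_rpow (abs_nonneg z) h' hp0.le
      linarith
    have hpow : |z| ^ (s - 1) = m ^ θ * (|z| ^ p / m) ^ θ := by
      rw [← Real.mul_rpow hm0.le (div_nonneg hz0 hm0.le), mul_div_cancel₀ _ hm0.ne',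
        ← Real.rpow_mul (abs_nonneg z), hθ, mul_div_cancel₀ _ hp0.ne']
    have hyoung := Real.geom_mean_le_arith_mean2_weighted hθ0 (sub_nonneg.2 hθ1)
      (div_nonneg hz0 hm0.le) zero_le_one (by ring)
    rw [Real.one_rpow, mul_one, mul_one] at hyoung
    have hle : (|z| ^ p / m) ^ θ ≤ (1 - θ) + θ / m * (B * (1 - t) + A * t) := by
      have h := mul_le_mul_of_nonneg_left hconv (div_nonneg hθ0 hm0.le)
      have e : θ * (|z| ^ p / m) = θ / m * |z| ^ p := by ring
      linarith
    have hs0 : 0 < s := by linarith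
    rw [Real.norm_eq_abs, abs_mul, abs_mul, abs_of_pos hs0,
      abs_of_nonneg (Real.rpow_nonneg (abs_nonneg z) _), hpow]
    calc s * (m ^ θ * (|z| ^ p / m) ^ θ) * |a - b|
        = s * |a - b| * m ^ θ * (|z| ^ p / m) ^ θ := by ring
      _ ≤ _ := mul_le_mul_of_nonneg_left hle (by positivity)
  have h := image_norm_le_of_norm_deriv_right_le_deriv_boundary (a := 0) (b := 1)
    (fun t _ => (hd t).continuousAt.continuousWithinAt)
    (fun t _ => (hd t).hasDerivWithinAt) (by simp) hbd key
    (Set.right_mem_Icc.2 zero_le_one)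
  rw [Real.norm_eq_abs, one_mul, add_sub_cancel] at h
  refine h.trans_eq ?_
  have e : (1 - θ) * 1 + θ / m * (B * (1 - 1 ^ 2 / 2) + A * (1 ^ 2 / 2)) = 1 := by
    have e' : B * (1 - 1 ^ 2 / 2) + A * (1 ^ 2 / 2) = m := by rw [hm]; ring
    rw [e', div_mul_cancel₀ _ hm0.ne']
    ring
  rw [e, mul_one]

/-- Real `ℓ_p`, for a real exponent `p`. -/
local notation "ℓ(" p ")" => lp (fun _ : ℕ => ℝ) (ENNReal.ofReal p)

theorem lp_summable_rpow {p : ℝ} (hp : 0 < p) (x : ℓ(p)) : Summable fun i => |x i| ^ p := by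
  have h := (lp.memℓp x).summable (by rwa [ENNReal.toReal_ofReal hp.le])
  simpa [ENNReal.toReal_ofReal hp.le] using h

theorem lp_norm_rpow {p : ℝ} (hp : 0 < p) (x : ℓ(p)) : ‖x‖ ^ p = ∑' i, |x i| ^ p := by
  have h := lp.norm_rpow_eq_tsum (by rwa [ENNReal.toReal_ofReal hp.le]) x
  simpa [ENNReal.toReal_ofReal hp.le] using h

theorem lp_norm_le_of_rpow_le {p C : ℝ} (hp : 0 < p) (hC : 0 ≤ C) {x : ℓ(p)}
    (h : ∑' i, |x i| ^ p ≤ C ^ p) : ‖x‖ ≤ C := by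
  rw [← lp_norm_rpow hp] at h
  exact (Real.rpow_le_rpow_iff (lp.norm_nonneg' x) hC hp).1 h

/-- The Mazur map from `ℓ_p` to `ℓ_q`, applying the signed `p / q`-th power coordinatewise. -/
def mazurMap {p q : ℝ} (hp : 0 < p) (hq : 0 < q) (x : ℓ(p)) : ℓ(q) :=
  ⟨fun i => signedPow (p / q) (x i), memℓp_gen <| by
    refine (lp_summable_rpow hp x).congr fun i => ?_
    rw [ENNReal.toReal_ofReal hq.le, Real.norm_eq_abs, abs_signedPow (div_pos hp hq),
      ← Real.rpow_mul (abs_nonneg _), div_mul_cancel₀ _ hq.ne']⟩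

theorem mazurMap_sub_apply {p q : ℝ} (hp : 0 < p) (hq : 0 < q) (x y : ℓ(p)) (i : ℕ) :
    (mazurMap hp hq x - mazurMap hp hq y) i =
      signedPow (p / q) (x i) - signedPow (p / q) (y i) := rfl

theorem le_norm_mazurMap_sub {p q : ℝ} (hp : 0 < p) (hq : 0 < q) (hqp : q ≤ p) (x y : ℓ(p)) :
    2 ^ (1 - p / q) * ‖x - y‖ ^ (p / q) ≤ ‖mazurMap hp hq x - mazurMap hp hq y‖ := by
  have hs : 1 ≤ p / q := (one_le_div hq).2 hqp
  have hc : (0 : ℝ) ≤ 2 ^ (1 - p / q) := by positivity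
  rw [← Real.rpow_le_rpow_iff (mul_nonneg hc (Real.rpow_nonneg (lp.norm_nonneg' _) _))
    (lp.norm_nonneg' _) hq,
    Real.mul_rpow hc (Real.rpow_nonneg (lp.norm_nonneg' _) _), ← Real.rpow_mul (lp.norm_nonneg' _),
    div_mul_cancel₀ _ hq.ne', lp_norm_rpow hp, lp_norm_rpow hq, ← tsum_mul_left]
  refine Summable.tsum_le_tsum (fun i => ?_) ((lp_summable_rpow hp _).mul_left _)
    (lp_summable_rpow hq _)
  rw [mazurMap_sub_apply]
  have h := Real.rpow_le_rpow (by positivity)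
    (abs_sub_rpow_le_abs_signedPow_sub hs (x i) (y i)) hq.le
  rwa [Real.mul_rpow hc (by positivity), ← Real.rpow_mul (abs_nonneg _),
    div_mul_cancel₀ _ hq.ne'] at h

theorem norm_mazurMap_sub_le {p q R : ℝ} (hp : 0 < p) (hq : 1 ≤ q) (hqp : q < p) {x y : ℓ(p)}
    (hx : ‖x‖ ≤ R) (hy : ‖y‖ ≤ R) :
    ‖mazurMap hp (zero_lt_one.trans_le hq) x - mazurMap hp (zero_lt_one.trans_le hq) y‖ ≤
      p / q * R ^ (p / q - 1) * ‖x - y‖ := by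
  have hq0 : 0 < q := by linarith
  have hR : 0 ≤ R := (lp.norm_nonneg' x).trans hx
  set s := p / q with hsdef
  have hs : 1 < s := (one_lt_div hq0).2 hqp
  have hs0 : 0 < s := by linarith
  have hqs : q * s = p := mul_div_cancel₀ _ hq0.ne'
  have hsp : s - 1 ≤ p := by nlinarith
  have hN : 0 ≤ ‖x - y‖ := lp.norm_nonneg' _
  refine lp_norm_le_of_rpow_le hq0 (by positivity) ?_
  set m : ℕ → ℝ := fun i => (|x i| ^ p + |y i| ^ p) / 2 with hm
  have hm0 : ∀ i, 0 ≤ m i := fun i => by positivity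
  have hmsum : Summable m := ((lp_summable_rpow hp x).add (lp_summable_rpow hp y)).div_const 2
  have hmle : ∑' i, m i ≤ R ^ p := by
    rw [hm, tsum_div_const, (lp_summable_rpow hp x).tsum_add (lp_summable_rpow hp y),
      ← lp_norm_rpow hp, ← lp_norm_rpow hp]
    have h1 := Real.rpow_le_rpow (lp.norm_nonneg' x) hx hp.le
    have h2 := Real.rpow_le_rpow (lp.norm_nonneg' y) hy hp.le
    linarith
  have hconj := Real.HolderConjugate.conjExponent hs
  set t := s.conjExponent with ht
  have htdef : t = s / (s - 1) := rfl
  have hs1 : s - 1 ≠ 0 := by linarith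
  have hfp : (fun i => (|(x - y) i| ^ q) ^ s) = fun i => |(x - y) i| ^ p := by
    funext i
    rw [← Real.rpow_mul (abs_nonneg _), hqs]
  have hgp : (fun i => (m i ^ (1 / t)) ^ t) = m := by
    funext i
    rw [← Real.rpow_mul (hm0 i), one_div_mul_cancel hconj.symm.ne_zero, Real.rpow_one]
  have hholder := Real.summable_and_inner_le_Lp_mul_Lq_tsum_of_nonneg hconj
    (f := fun i => |(x - y) i| ^ q) (g := fun i => m i ^ (1 / t))
    (fun i => by positivity) (fun i => Real.rpow_nonneg (hm0 i) _)
    (by rw [hfp]; exact lp_summable_rpow hp _) (by rw [hgp]; exact hmsum)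
  rw [hfp, hgp, ← lp_norm_rpow hp] at hholder
  obtain ⟨hsumm, hle⟩ := hholder
  have hexp : (s - 1) / p * q = 1 / t := by
    rw [htdef, ← hqs]
    field_simp
  have hpt (i : ℕ) : |(mazurMap hp (zero_lt_one.trans_le hq) x -
      mazurMap hp (zero_lt_one.trans_le hq) y) i| ^ q ≤
        s ^ q * (|(x - y) i| ^ q * m i ^ (1 / t)) := by
    rw [mazurMap_sub_apply]
    have h := Real.rpow_le_rpow (abs_nonneg _)
      (abs_signedPow_sub_le hs (by linarith) hsp (x i) (y i)) hq0.le
    rwa [Real.mul_rpow (by positivity) (Real.rpow_nonneg (hm0 i) _),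
      Real.mul_rpow hs0.le (abs_nonneg _), ← Real.rpow_mul (hm0 i), hexp, mul_assoc] at h
  calc _ ≤ ∑' i, s ^ q * (|(x - y) i| ^ q * m i ^ (1 / t)) :=
        (lp_summable_rpow hq0 _).tsum_le_tsum hpt (hsumm.mul_left _)
    _ ≤ s ^ q * ((‖x - y‖ ^ p) ^ (1 / s) * (R ^ p) ^ (1 / t)) := by
        rw [tsum_mul_left]
        refine mul_le_mul_of_nonneg_left (hle.trans ?_) (by positivity)
        refine mul_le_mul_of_nonneg_left ?_ (by positivity)
        exact Real.rpow_le_rpow (tsum_nonneg hm0) hmle (one_div_nonneg.2 hconj.symm.nonneg)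
    _ = (s * R ^ (s - 1) * ‖x - y‖) ^ q := by
        rw [Real.mul_rpow (by positivity) hN, Real.mul_rpow hs0.le (by positivity),
          ← Real.rpow_mul hN, ← Real.rpow_mul hR, ← Real.rpow_mul hR]
        have e1 : p * (1 / s) = q := by rw [← hqs]; field_simp
        have e2 : p * (1 / t) = (s - 1) * q := by rw [htdef, ← hqs]; field_simp
        rw [e1, e2]
        ring

instance infinite_lp (p : ℝ) : Infinite ℓ(p) :=
  Infinite.of_injective (fun n : ℕ => lp.single (ENNReal.ofReal p) 0 (n : ℝ)) fun a b h => by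
    have := congrArg (fun f : ℓ(p) => f 0) h
    simpa using this

/-- Gluing: if every partition into clusters of diameter at most `Δ₁` can be randomly refined so
that clusters get diameter at most `Δ` and points of a common cluster are separated with
probability at most `γ * dist x y`, the refined random partition is a Lipschitz decomposition. -/
theorem LipschitzDecomp.refine {α : Type*} [PseudoMetricSpace α] {β Δ₁ β' Δ γ : ℝ}
    (h : LipschitzDecomp α β Δ₁) (hβ : 0 ≤ β) (hΔ₁ : 0 < Δ₁) (hγ : 0 ≤ γ)
    (hsum : β / Δ₁ + γ ≤ β' / Δ)
    (href : ∀ R : Setoid α, (∀ x y, R.r x y → dist x y ≤ Δ₁) → ∃ E : PMF (Setoid α),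
      (∀ S ∈ E.support, ∀ x y, R.r x y → S.r x y → dist x y ≤ Δ) ∧
      ∀ x y, R.r x y → E.toOuterMeasure {S | ¬ S.r x y} ≤ ENNReal.ofReal (γ * dist x y)) :
    LipschitzDecomp α β' Δ := by
  classical
  obtain ⟨D, hdiam, hsep⟩ := h
  have href' : ∀ R : Setoid α, ∃ E : PMF (Setoid α), R ∈ D.support →
      (∀ S ∈ E.support, ∀ x y, R.r x y → S.r x y → dist x y ≤ Δ) ∧
      ∀ x y, R.r x y → E.toOuterMeasure {S | ¬ S.r x y} ≤ ENNReal.ofReal (γ * dist x y) := by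
    intro R
    by_cases hR : R ∈ D.support
    · obtain ⟨E, hE⟩ := href R (hdiam R hR)
      exact ⟨E, fun _ => hE⟩
    · exact ⟨PMF.pure R, fun h => absurd h hR⟩
  choose E hE using href'
  refine ⟨D.bind fun R => (E R).map fun S => R ⊓ S, ?_, ?_⟩
  · intro T hT x y hxy
    obtain ⟨R, hR, hT⟩ := (PMF.mem_support_bind_iff _ _ _).1 hT
    obtain ⟨S, hS, rfl⟩ := (PMF.mem_support_map_iff _ _ _).1 hT
    exact (hE R hR).1 S hS x y hxy.1 hxy.2
  · intro x y
    rw [PMF.toOuterMeasure_bind_apply]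
    have hle : ∀ R, D R * ((E R).map fun S => R ⊓ S).toOuterMeasure {T | ¬ T.r x y} ≤
        {R : Setoid α | ¬ R.r x y}.indicator D R + D R * ENNReal.ofReal (γ * dist x y) := by
      intro R
      by_cases hxy : R.r x y
      · by_cases hR : R ∈ D.support
        · refine le_add_left (mul_le_mul_right ?_ _)
          rw [PMF.toOuterMeasure_map_apply]
          refine le_trans (MeasureTheory.OuterMeasure.mono _ ?_) ((hE R hR).2 x y hxy)
          intro S hS hS'
          exact hS ⟨hxy, hS'⟩
        · simp [(D.apply_eq_zero_iff R).2 hR]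
      · refine le_add_right ?_
        rw [Set.indicator_of_mem (show R ∈ {R : Setoid α | ¬ R.r x y} from hxy)]
        refine (mul_le_mul_right ?_ _).trans_eq (mul_one _)
        rw [PMF.toOuterMeasure_apply, ← PMF.tsum_coe ((E R).map fun S => R ⊓ S)]
        exact ENNReal.tsum_le_tsum fun T => Set.indicator_le_self _ _ T
    refine (ENNReal.tsum_le_tsum hle).trans ?_
    rw [ENNReal.tsum_add, ENNReal.tsum_mul_right, D.tsum_coe, one_mul, ← PMF.toOuterMeasure_apply]
    refine (add_le_add_left (hsep x y) _).trans ?_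
    rw [← ENNReal.ofReal_add (by positivity) (by positivity)]
    refine ENNReal.ofReal_le_ofReal ?_
    have := mul_le_mul_of_nonneg_right hsum (dist_nonneg (x := x) (y := y))
    calc _ = (β / Δ₁ + γ) * dist x y := by ring
      _ ≤ _ := this
      _ = _ := by ring

/-- The choice of the intermediate scale `Δ₁` balancing the two separation probabilities. -/
theorem exists_scale_balancing {s β b Δ : ℝ} (hs : 0 < s) (hβ : 0 < β) (hb : 0 < b)
    (hΔ : 0 < Δ) : ∃ Δ₁ : ℝ, 0 < Δ₁ ∧
      β / Δ₁ + b * (s * Δ₁ ^ (s - 1)) / (2 ^ (1 - s) * Δ ^ s) =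
        4 * (s / 2) ^ s⁻¹ * b ^ s⁻¹ * β ^ (1 - s⁻¹) / Δ := by
  set v := (s / 2 * b / β) ^ s⁻¹ with hv
  have hv0 : 0 < v := by positivity
  have hvs : v ^ s = s / 2 * b / β := by
    rw [hv, ← Real.rpow_mul (by positivity), inv_mul_cancel₀ hs.ne', Real.rpow_one]
  refine ⟨Δ / (2 * v), by positivity, ?_⟩
  have h1 : (s / 2) ^ s⁻¹ * b ^ s⁻¹ * β ^ (1 - s⁻¹) = β * v := by
    rw [hv, Real.div_rpow (by positivity) hβ.le, Real.mul_rpow (by positivity) hb.le,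
      Real.rpow_sub hβ, Real.rpow_one]
    ring
  have h2 : (Δ / (2 * v)) ^ (s - 1) / (2 ^ (1 - s) * Δ ^ s) = v / v ^ s / Δ := by
    rw [Real.div_rpow hΔ.le (by positivity), Real.mul_rpow (by norm_num) hv0.le,
      Real.rpow_sub_one hΔ.ne', Real.rpow_sub_one hv0.ne', Real.rpow_sub_one (by norm_num),
      Real.rpow_sub (by norm_num), Real.rpow_one]
    have : (0 : ℝ) < 2 ^ s := by positivity
    have : 0 < Δ ^ s := by positivity
    have : 0 < v ^ s := by positivity
    field_simp
  calc _ = β / (Δ / (2 * v)) + b * s *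
        ((Δ / (2 * v)) ^ (s - 1) / (2 ^ (1 - s) * Δ ^ s)) := by ring
    _ = 4 * (β * v) / Δ := by
      rw [h2, hvs]
      field_simp
      ring
    _ = _ := by
      rw [← h1]
      ring

theorem Set.Finite.exists_superset_finite_ncard_eq {α : Type*} [Infinite α] {s : Set α}
    (hs : s.Finite) {k : ℕ} (hk : s.ncard ≤ k) : ∃ t, s ⊆ t ∧ t.Finite ∧ t.ncard = k := by
  rcases k.eq_zero_or_pos with rfl | hk0
  · exact ⟨s, subset_rfl, hs, Nat.le_zero.1 hk⟩
  · obtain ⟨t, hst, -, ht⟩ := Set.infinite_univ.exists_superset_ncard_eq (Set.subset_univ s) hs hk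
    exact ⟨t, hst, Set.finite_of_ncard_pos (ht ▸ hk0), ht⟩

/-- One step of the recursive decomposition lemma: if an `n`-point `M ⊆ ℓ_p` admits a
`(β, Δ')`-Lipschitz decomposition for every `Δ' > 0`, and every `n`-point subset of `ℓ_q`
admits a `(β_q, Δ')`-Lipschitz decomposition for every `Δ' > 0` (where `2 ≤ q < p`), then
for every `Δ > 0`, `M` admits a `(β_new, Δ)`-Lipschitz decomposition with
`β_new = 4 * (p/(2q))^(q/p) * β_q^(q/p) * β^(1 - q/p)`. -/
theorem iterative_decomposition (p q : ℝ) (hq : 2 ≤ q) (hqp : q < p)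
    [Fact (1 ≤ ENNReal.ofReal p)] [Fact (1 ≤ ENNReal.ofReal q)]
    (n : ℕ)
    (M : Set (lp (fun _ : ℕ => ℝ) (ENNReal.ofReal p))) (hMfin : M.Finite)
    (hMcard : M.ncard = n)
    (β βq : ℝ) (hβ : 1 ≤ β) (hβq : 1 ≤ βq)
    (hM : ∀ Δ' : ℝ, 0 < Δ' → LipschitzDecomp M β Δ')
    (hq' : ∀ (N : Set (lp (fun _ : ℕ => ℝ) (ENNReal.ofReal q))),
        N.Finite → N.ncard = n → ∀ Δ' : ℝ, 0 < Δ' → LipschitzDecomp N βq Δ')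
    (Δ : ℝ) (hΔ : 0 < Δ) :
    LipschitzDecomp M
      (4 * (p / (2 * q)) ^ (q / p) * βq ^ (q / p) * β ^ (1 - q / p)) Δ := by
  have hq0 : 0 < q := by linarith
  have hp0 : 0 < p := by linarith
  have hs0 : 0 < p / q := div_pos hp0 hq0
  have hβ0 : 0 < β := by linarith
  have hβq0 : 0 < βq := by linarith
  obtain ⟨Δ₁, hΔ₁, hscale⟩ := exists_scale_balancing hs0 hβ0 hβq0 hΔ
  rw [inv_div, div_div, mul_comm q 2] at hscale
  refine (hM Δ₁ hΔ₁).refine hβ0.le hΔ₁ (by positivity) hscale.le fun R hR => ?_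
  let center (x : M) : M := (Quotient.mk R x).out
  have hcenter (x : M) : R.r x (center x) := R.symm (Quotient.mk_out x)
  have hcenter_eq (x y : M) (hxy : R.r x y) : center x = center y :=
    congrArg Quotient.out (Quotient.sound hxy)
  let G (x : M) : ℓ(q) := mazurMap hp0 hq0 ((x : ℓ(p)) - center x)
  have : Finite M := hMfin
  have hcard : (Set.range G).ncard ≤ n := by
    rw [← Set.image_univ, ← hMcard, ← Nat.card_coe_set_eq M, ← Set.ncard_univ]
    exact Set.ncard_image_le Set.finite_univ
  obtain ⟨N, hGN, hNfin, hN⟩ := (Set.finite_range G).exists_superset_finite_ncard_eq hcard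
  have hΔ₂ : (0 : ℝ) < 2 ^ (1 - p / q) * Δ ^ (p / q) := by positivity
  obtain ⟨E, hdiam, hsep⟩ := hq' N hNfin hN _ hΔ₂
  let g (x : M) : N := ⟨G x, hGN ⟨x, rfl⟩⟩
  refine ⟨E.map (Setoid.comap g), ?_, ?_⟩
  · intro S hS x y hxy hSxy
    obtain ⟨T, hT, rfl⟩ := (PMF.mem_support_map_iff _ _ _).1 hS
    have h := hdiam T hT (g x) (g y) hSxy
    rw [Subtype.dist_eq, dist_eq_norm] at h
    have h' := (le_norm_mazurMap_sub hp0 hq0 hqp.le ((x : ℓ(p)) - center x)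
      ((y : ℓ(p)) - center y)).trans h
    rw [hcenter_eq x y hxy, sub_sub_sub_cancel_right] at h'
    rw [Subtype.dist_eq, dist_eq_norm]
    exact (Real.rpow_le_rpow_iff (norm_nonneg _) hΔ.le hs0).1
      (le_of_mul_le_mul_left h' (by positivity))
  · intro x y hxy
    rw [PMF.toOuterMeasure_map_apply]
    refine (hsep (g x) (g y)).trans (ENNReal.ofReal_le_ofReal ?_)
    have hxn : ‖(x : ℓ(p)) - center x‖ ≤ Δ₁ := by
      rw [← dist_eq_norm]
      exact hR _ _ (hcenter x)
    have hyn : ‖(y : ℓ(p)) - center y‖ ≤ Δ₁ := by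
      rw [← dist_eq_norm]
      exact hR _ _ (hcenter y)
    have hup := norm_mazurMap_sub_le hp0 (by linarith) hqp hxn hyn
    have e : ((x : ℓ(p)) - center x) - ((y : ℓ(p)) - center y) = x - y := by
      rw [hcenter_eq x y hxy, sub_sub_sub_cancel_right]
    rw [e, ← dist_eq_norm, ← dist_eq_norm] at hup
    rw [div_mul_eq_mul_div]
    refine div_le_div_of_nonneg_right ?_ hΔ₂.le
    rw [mul_assoc]
    exact mul_le_mul_of_nonneg_left hup hβq0.le
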